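/- Let S, T, U be locally finite groupoids and M, N finite groupoids, with functors P : M ⥤ S, Q : M ⥤ T, R : N ⥤ T, V : N ⥤ U (two composable spans of groupoids). Let M ×_T N = Comma(Q, R) denote the homotopy pullback, with its induced functor to S × U sending (m, n, φ) to (P(m), V(n)). Then for every object s of S and u of U, the homotopy fibre of M ×_T N over (s,u) is a finite groupoid and its cardinality is |(M ×_T N)_{(s,u)}| = Σ_{[t]∈π₀T} |M_{(s,t)}| · |N_{(t,u)}| / #Aut(t), where M_{(s,t)} denotes the homotopy fibre of the functor (P,Q) : M ⥤ S × T over (s,t), N_{(t,u)} the homotopy fibre of (R,V) : N ⥤ T × U over (t,u), and the sum ranges over the isomorphism classes of objects of T. -/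

import Mathlib

open CategoryTheory

/-- Isomorphism classes of objects of a category. -/
abbrev IsoCls (C : Type*) [Category C] := Quotient (CategoryTheory.isIsomorphicSetoid C)

/-- A category is locally finite if all of its hom-sets are finite. -/
def LocallyFiniteCat (C : Type*) [Category C] : Prop := ∀ x y : C, Finite (x ⟶ y)

/-- A category is finite (as a homotopy type) if all hom-sets are finite and it has
finitely many isomorphism classes of objects. -/
def FiniteCat (C : Type*) [Category C] : Prop :=
  (∀ x y : C, Finite (x ⟶ y)) ∧ Finite (IsoCls C)

/-- Homotopy cardinality: the sum over isomorphism classes of the reciprocal of the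
order of the automorphism group. -/
noncomputable def gcard (C : Type*) [Category C] : ℚ :=
  ∑ᶠ X : IsoCls C, (Nat.card (Aut X.out) : ℚ)⁻¹

theorem natCard_prod_hom {C D : Type*} [Category C] [Category D] (c c' : C) (d d' : D) :
    Nat.card ((c, d) ⟶ (c', d')) = Nat.card (c ⟶ c') * Nat.card (d ⟶ d') :=
  Nat.card_prod (c ⟶ c') (d ⟶ d')

theorem natCard_hom_congr {C : Type*} [Category C] {x x' y y' : C} (e : x ≅ x') (f : y ≅ y') :
    Nat.card (x ⟶ y) = Nat.card (x' ⟶ y') :=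
  Nat.card_congr (e.homCongr f)

theorem natCard_aut {C : Type*} [Category C] (hC : ∀ {x y : C} (f : x ⟶ y), IsIso f) (x : C) :
    Nat.card (Aut x) = Nat.card (x ⟶ x) :=
  Nat.card_congr
    { toFun := fun f => f.hom
      invFun := fun f => haveI := hC f; asIso f
      left_inv := fun f => by ext; rfl
      right_inv := fun f => rfl }

theorem isoCls_nonempty_iso {C : Type*} [Category C] (x : C) :
    Nonempty ((⟦x⟧ : IsoCls C).out ≅ x) :=
  Quotient.exact (Quotient.out_eq (⟦x⟧ : IsoCls C))

theorem isoCls_eq_of_hom {C : Type*} [Groupoid C] {c d : IsoCls C} (f : c.out ⟶ d.out) :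
    c = d := by
  rw [← Quotient.out_eq c, ← Quotient.out_eq d]
  exact Quotient.sound ⟨asIso f⟩

/-- The cardinality of a category with invertible morphisms, computed from a finite family of
objects meeting every isomorphism class, possibly several times. -/
theorem gcard_eq_sum_of_family {X I : Type*} [Category X] [Fintype I]
    (hX : ∀ {x y : X} (f : x ⟶ y), IsIso f) (obj : I → X)
    (hfin : ∀ i j, Finite (obj i ⟶ obj j)) (hobj : ∀ x, ∃ i, Nonempty (obj i ≅ x)) :
    FiniteCat X ∧ gcard X = ∑ i, (Nat.card (Σ j, obj i ⟶ obj j) : ℚ)⁻¹ := by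
  classical
  have hhom : ∀ x y : X, Finite (x ⟶ y) := fun x y => by
    obtain ⟨i, ⟨e⟩⟩ := hobj x
    obtain ⟨j, ⟨f⟩⟩ := hobj y
    exact Finite.of_equiv _ (e.homCongr f)
  let cls : I → IsoCls X := fun i => ⟦obj i⟧
  have hcls : Function.Surjective cls := fun c => by
    obtain ⟨i, ⟨e⟩⟩ := hobj c.out
    have : cls i = ⟦c.out⟧ := Quotient.sound ⟨e⟩
    exact ⟨i, this.trans (Quotient.out_eq c)⟩
  have : Finite (IsoCls X) := Finite.of_surjective cls hcls
  refine ⟨⟨hhom, this⟩, ?_⟩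
  have := Fintype.ofFinite (IsoCls X)
  rw [gcard, finsum_eq_sum_of_fintype, ← Finset.sum_fiberwise Finset.univ cls]
  refine Finset.sum_congr rfl fun c _ => ?_
  have hcount : ∀ i ∈ Finset.univ.filter (fun i => cls i = c),
      (Nat.card (Σ j, obj i ⟶ obj j) : ℚ)⁻¹ =
        ((Finset.univ.filter (fun i => cls i = c)).card * Nat.card (Aut c.out) : ℚ)⁻¹ := by
    intro i hi
    obtain rfl : cls i = c := (Finset.mem_filter.1 hi).2
    congr 1
    rw [Nat.card_sigma]
    push_cast
    rw [← Finset.sum_filter_add_sum_filter_not Finset.univ (fun j => cls j = cls i),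
      Finset.sum_eq_zero (s := Finset.univ.filter (fun j => ¬ cls j = cls i)), add_zero,
      Finset.sum_congr (g := fun _ => (Nat.card (Aut (cls i).out) : ℚ)) rfl, Finset.sum_const,
      nsmul_eq_mul]
    · intro j hj
      obtain ⟨e⟩ := isoCls_nonempty_iso (obj i)
      obtain ⟨f⟩ : Nonempty (obj j ≅ obj i) := Quotient.exact (Finset.mem_filter.1 hj).2
      rw [natCard_aut hX, natCard_hom_congr e.symm (f ≪≫ e.symm)]
    · intro j hj
      have : IsEmpty (obj i ⟶ obj j) := ⟨fun f => (Finset.mem_filter.1 hj).2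
        (haveI := hX f; (Quotient.sound ⟨asIso f⟩ : cls i = cls j).symm)⟩
      simp
  rw [Finset.sum_congr rfl hcount, Finset.sum_const, nsmul_eq_mul, mul_inv, ← mul_assoc,
    mul_inv_cancel₀, one_mul]
  obtain ⟨i, hi⟩ := hcls c
  exact Nat.cast_ne_zero.2 (Finset.card_ne_zero.2 ⟨i, by simp [hi]⟩)

/-- The cardinality of a category of elements: the objects of `X` are, up to isomorphism, the pairs
of an object `e` of `E` and an element of `H e`, with morphisms the compatible morphisms of `E`.
The family `rep` picks one object from every isomorphism class of `E`. -/
theorem gcard_eq_sum_of_elements {X E J : Type*} [Category X] [Groupoid E] [Fintype J]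
    (hX : ∀ {x y : X} (f : x ⟶ y), IsIso f) (hE : LocallyFiniteCat E)
    (rep : J → E) (hinj : ∀ {i j}, (rep i ⟶ rep j) → i = j)
    (hsurj : ∀ e, ∃ j, Nonempty (e ⟶ rep j))
    (H : E → Type*) [∀ e, Finite (H e)] (act : ∀ {e e' : E}, (e ⟶ e') → H e → H e')
    (mk : ∀ e, H e → X)
    (homEquiv : ∀ {e e' : E} (h : H e) (h' : H e'),
      (mk e h ⟶ mk e' h') ≃ {f : e ⟶ e' // act f h = h'})
    (hmk : ∀ x, ∃ e h, Nonempty (mk e h ≅ x)) :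
    FiniteCat X ∧
      gcard X = ∑ j, (Nat.card (H (rep j)) : ℚ) / Nat.card (rep j ⟶ rep j) := by
  have hE' : ∀ e e' : E, Finite (e ⟶ e') := hE
  have := fun e => Fintype.ofFinite (H e)
  obtain ⟨hfin, hcard⟩ := gcard_eq_sum_of_family hX
    (fun i : Σ j, H (rep j) => mk (rep i.1) i.2)
    (fun i j => Finite.of_equiv _ (homEquiv i.2 j.2).symm)
    (fun x => by
      obtain ⟨e, h, ⟨k⟩⟩ := hmk x
      obtain ⟨j, ⟨f⟩⟩ := hsurj e
      let g := (homEquiv h (act f h)).symm ⟨f, rfl⟩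
      have := hX g
      exact ⟨⟨j, act f h⟩, ⟨(asIso g).symm ≪≫ k⟩⟩)
  refine ⟨hfin, hcard.trans ?_⟩
  rw [Fintype.sum_sigma]
  refine Finset.sum_congr rfl fun j _ => ?_
  have hcount : ∀ h : H (rep j),
      Nat.card (Σ i : Σ j, H (rep j), mk (rep j) h ⟶ mk (rep i.1) i.2) =
        Nat.card (rep j ⟶ rep j) := fun h => by
    symm
    refine Nat.card_eq_of_bijective
      (fun f => ⟨⟨j, act f h⟩, (homEquiv h (act f h)).symm ⟨f, rfl⟩⟩) ⟨?_, ?_⟩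
    · have key : Function.LeftInverse
          (fun p : Σ i : Σ j, H (rep j), mk (rep j) h ⟶ mk (rep i.1) i.2 =>
            (⟨p.1.1, (homEquiv h p.1.2 p.2).1⟩ : Σ i, (rep j ⟶ rep i)))
          (fun p : Σ i, (rep j ⟶ rep i) =>
            ⟨⟨p.1, act p.2 h⟩, (homEquiv h (act p.2 h)).symm ⟨p.2, rfl⟩⟩) := fun p => by simp
      exact key.injective.comp sigma_mk_injective
    · rintro ⟨⟨i, h'⟩, g⟩
      obtain ⟨⟨f, hf⟩, rfl⟩ := (homEquiv h h').symm.surjective g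
      obtain rfl := hinj f
      subst hf
      exact ⟨f, rfl⟩
  simp only [hcount, Finset.sum_const, Finset.card_univ, nsmul_eq_mul, div_eq_mul_inv,
    Nat.card_eq_fintype_card (α := H (rep j))]

/-- The cardinality of the homotopy fibre of a functor between groupoids. -/
theorem gcard_structuredArrow {E B : Type*} [Groupoid E] [Groupoid B] (hE : FiniteCat E)
    (hB : LocallyFiniteCat B) [Fintype (IsoCls E)] (p : E ⥤ B) (b : B) :
    gcard (StructuredArrow b p) =
      ∑ e : IsoCls E, (Nat.card (b ⟶ p.obj e.out) : ℚ) / Nat.card (e.out ⟶ e.out) := by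
  have : ∀ x y : B, Finite (x ⟶ y) := hB
  refine (gcard_eq_sum_of_elements (X := StructuredArrow b p) (fun {x y} f => ?_) hE.1
    (fun e : IsoCls E => e.out) isoCls_eq_of_hom
    (fun e => ⟨⟦e⟧, (isoCls_nonempty_iso e).map Iso.inv⟩)
    (fun e => b ⟶ p.obj e) (fun f h => h ≫ p.map f) (fun _ h => StructuredArrow.mk h)
    (fun h h' =>
      { toFun := fun g : StructuredArrow.mk h ⟶ StructuredArrow.mk h' =>
          ⟨g.right, StructuredArrow.w g⟩
        invFun := fun f => StructuredArrow.homMk f.1 f.2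
        left_inv := fun g => by ext; rfl
        right_inv := fun f => rfl })
    (fun x => ⟨x.right, x.hom, ⟨Iso.refl x⟩⟩)).2
  exact (StructuredArrow.isoMk (asIso f.right) (StructuredArrow.w f)).isIso_hom

theorem sum_isoCls_natCard_hom {T : Type*} [Groupoid T] (hT : LocallyFiniteCat T) (x y : T) :
    (Function.support fun t : IsoCls T => (Nat.card (t.out ⟶ x) : ℚ) * Nat.card (t.out ⟶ y) /
      Nat.card (Aut t.out)).Finite ∧
    ∑ᶠ t : IsoCls T, (Nat.card (t.out ⟶ x) : ℚ) * Nat.card (t.out ⟶ y) / Nat.card (Aut t.out) =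
      Nat.card (x ⟶ y) := by
  have hzero : ∀ t : IsoCls T, t ≠ ⟦x⟧ →
      (Nat.card (t.out ⟶ x) : ℚ) * Nat.card (t.out ⟶ y) / Nat.card (Aut t.out) = 0 := by
    intro t ht
    have : IsEmpty (t.out ⟶ x) := ⟨fun f => ht <| by
      rw [← Quotient.out_eq t]
      exact Quotient.sound ⟨asIso f⟩⟩
    simp
  refine ⟨(Set.finite_singleton (⟦x⟧ : IsoCls T)).subset fun t ht => ?_, ?_⟩
  · by_contra h
    exact ht (hzero t h)
  · obtain ⟨e⟩ := isoCls_nonempty_iso x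
    have := hT x x
    rw [finsum_eq_single _ _ hzero, natCard_aut (fun f => inferInstance),
      natCard_hom_congr e (Iso.refl x), natCard_hom_congr e (Iso.refl y), natCard_hom_congr e e,
      mul_div_cancel_left₀ _ (Nat.cast_ne_zero.2 Nat.card_pos.ne')]

/-- The cardinality of the homotopy fibre of the homotopy pullback of two spans. -/
theorem gcard_structuredArrow_comma {S T U M N : Type*}
    [Groupoid S] [Groupoid T] [Groupoid U] [Groupoid M] [Groupoid N]
    (hS : LocallyFiniteCat S) (hT : LocallyFiniteCat T) (hU : LocallyFiniteCat U)
    (hM : FiniteCat M) (hN : FiniteCat N) [Fintype (IsoCls M)] [Fintype (IsoCls N)]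
    (P : M ⥤ S) (Q : M ⥤ T) (R : N ⥤ T) (V : N ⥤ U) (s : S) (u : U) :
    FiniteCat (StructuredArrow (s, u) ((Comma.fst Q R ⋙ P).prod' (Comma.snd Q R ⋙ V))) ∧
    gcard (StructuredArrow (s, u) ((Comma.fst Q R ⋙ P).prod' (Comma.snd Q R ⋙ V))) =
      ∑ p : IsoCls M × IsoCls N,
        (Nat.card ((s ⟶ P.obj p.1.out) × (u ⟶ V.obj p.2.out) ×
            (Q.obj p.1.out ⟶ R.obj p.2.out)) : ℚ) /
          Nat.card ((p.1.out, p.2.out) ⟶ (p.1.out, p.2.out)) := by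
  have : ∀ x y : S, Finite (x ⟶ y) := hS
  have : ∀ x y : T, Finite (x ⟶ y) := hT
  have : ∀ x y : U, Finite (x ⟶ y) := hU
  have : ∀ x y : M, Finite (x ⟶ y) := hM.1
  have : ∀ x y : N, Finite (x ⟶ y) := hN.1
  refine gcard_eq_sum_of_elements
    (X := StructuredArrow (s, u) ((Comma.fst Q R ⋙ P).prod' (Comma.snd Q R ⋙ V)))
    (fun {x y} f => ?_) (E := M × N)
    (fun x y => inferInstanceAs (Finite ((x.1 ⟶ y.1) × (x.2 ⟶ y.2))))
    (fun p : IsoCls M × IsoCls N => (p.1.out, p.2.out))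
    (fun {i j} (f : (i.1.out, i.2.out) ⟶ (j.1.out, j.2.out)) =>
      Prod.ext (isoCls_eq_of_hom f.1) (isoCls_eq_of_hom f.2))
    (fun e => ?_)
    (fun e => (s ⟶ P.obj e.1) × (u ⟶ V.obj e.2) × (Q.obj e.1 ⟶ R.obj e.2))
    (fun f h => (h.1 ≫ P.map f.1, h.2.1 ≫ V.map f.2, inv (Q.map f.1) ≫ h.2.2 ≫ R.map f.2))
    (fun e h => StructuredArrow.mk (Y := (⟨e.1, e.2, h.2.2⟩ : Comma Q R))
      ((h.1, h.2.1) : (s, u) ⟶ (P.obj e.1, V.obj e.2)))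
    (fun {e e'} h h' =>
      { toFun := fun g => ⟨(g.right.left, g.right.right), ?_⟩
        invFun := fun f => StructuredArrow.homMk ⟨f.1.1, f.1.2, ?_⟩ ?_
        left_inv := fun g => by ext <;> rfl
        right_inv := fun f => rfl })
    (fun x => ⟨(x.right.left, x.right.right), (x.hom.1, x.hom.2, x.right.hom), ⟨Iso.refl x⟩⟩)
  · have : IsIso f.right :=
      (Comma.isoMk (asIso f.right.left) (asIso f.right.right) f.right.w).isIso_hom
    exact (StructuredArrow.isoMk (asIso f.right) (StructuredArrow.w f)).isIso_hom
  · obtain ⟨a⟩ := isoCls_nonempty_iso e.1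
    obtain ⟨b⟩ := isoCls_nonempty_iso e.2
    exact ⟨(⟦e.1⟧, ⟦e.2⟧), ⟨(a.inv, b.inv)⟩⟩
  · have w := StructuredArrow.w g
    have w₁ := congrArg Prod.fst w
    have w₂ := congrArg Prod.snd w
    refine Prod.ext w₁ (Prod.ext w₂ ?_)
    exact (IsIso.inv_comp_eq _).2 g.right.w.symm
  · obtain ⟨f, rfl⟩ := f
    simp
  · obtain ⟨f, rfl⟩ := f
    rfl

/-- Composition of spans corresponds to matrix product: for composable spans
`S ⟵ M ⟶ T` and `T ⟵ N ⟶ U` of groupoids with `S`, `T`, `U` locally finite and `M`,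
`N` finite, the homotopy fibre of the homotopy pullback `M ×_T N = Comma Q R` over
`(s, u)` is finite, of cardinality `Σ_{[t]} |M_{(s,t)}| · |N_{(t,u)}| / #Aut(t)`. -/
theorem span_composition_card {S T U M N : Type*}
    [Groupoid S] [Groupoid T] [Groupoid U] [Groupoid M] [Groupoid N]
    (hS : LocallyFiniteCat S) (hT : LocallyFiniteCat T) (hU : LocallyFiniteCat U)
    (hM : FiniteCat M) (hN : FiniteCat N)
    (P : M ⥤ S) (Q : M ⥤ T) (R : N ⥤ T) (V : N ⥤ U) (s : S) (u : U) :
    FiniteCat (StructuredArrow (s, u) ((Comma.fst Q R ⋙ P).prod' (Comma.snd Q R ⋙ V))) ∧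
    gcard (StructuredArrow (s, u) ((Comma.fst Q R ⋙ P).prod' (Comma.snd Q R ⋙ V))) =
      ∑ᶠ t : IsoCls T,
        gcard (StructuredArrow (s, t.out) (P.prod' Q)) *
          gcard (StructuredArrow (t.out, u) (R.prod' V)) / (Nat.card (Aut t.out) : ℚ) := by
  have := hM.2
  have := hN.2
  have := Fintype.ofFinite (IsoCls M)
  have := Fintype.ofFinite (IsoCls N)
  obtain ⟨hfin, hcard⟩ := gcard_structuredArrow_comma hS hT hU hM hN P Q R V s u
  refine ⟨hfin, hcard.trans ?_⟩
  have hST : LocallyFiniteCat (S × T) := fun x y =>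
    have := hS x.1 y.1
    have := hT x.2 y.2
    inferInstanceAs (Finite ((x.1 ⟶ y.1) × (x.2 ⟶ y.2)))
  have hTU : LocallyFiniteCat (T × U) := fun x y =>
    have := hT x.1 y.1
    have := hU x.2 y.2
    inferInstanceAs (Finite ((x.1 ⟶ y.1) × (x.2 ⟶ y.2)))
  let w : IsoCls M × IsoCls N → ℚ := fun p =>
    Nat.card (s ⟶ P.obj p.1.out) * Nat.card (u ⟶ V.obj p.2.out) /
      (Nat.card (p.1.out ⟶ p.1.out) * Nat.card (p.2.out ⟶ p.2.out))
  let c : IsoCls M × IsoCls N → IsoCls T → ℚ := fun p t =>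
    (Nat.card (t.out ⟶ Q.obj p.1.out) : ℚ) * Nat.card (t.out ⟶ R.obj p.2.out) /
      Nat.card (Aut t.out)
  have hc := fun p : IsoCls M × IsoCls N =>
    sum_isoCls_natCard_hom hT (Q.obj p.1.out) (R.obj p.2.out)
  calc
    _ = ∑ p, w p * ∑ᶠ t, c p t := by
      refine Finset.sum_congr rfl fun p _ => ?_
      rw [(hc p).2, natCard_prod_hom]
      simp only [Nat.card_prod, w]
      push_cast
      ring
    _ = ∑ᶠ t, ∑ p, w p * c p t := by
      rw [finsum_sum_comm _ _ fun p _ => (hc p).1.subset fun t ht => right_ne_zero_of_mul ht]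
      exact Finset.sum_congr rfl fun p _ => mul_finsum' _ _ (hc p).1
    _ = _ := by
      refine finsum_congr fun t => ?_
      rw [gcard_structuredArrow hM hST, gcard_structuredArrow hN hTU, Finset.sum_mul_sum,
        ← Finset.sum_product', Finset.sum_div]
      refine Finset.sum_congr rfl fun p _ => ?_
      simp only [Functor.prod'_obj, natCard_prod_hom, w, c]
      push_cast
      ring
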